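/- Let d be a metric on X with respect to which the action T is 1-Lipschitz, and let x ∈ X be a transitive point. Then every S ∈ Λ = {S ∈ C_d(X) : S T_g = T_g S for all g ∈ G} is a uniform limit of the maps T_g: for every ε > 0 there exists g ∈ G with sup_{y ∈ X} d(T_g y, S y) < ε. Hence Λ equals the closure of {T_g : g ∈ G} in C_d(X). -/

import Mathlib

/-- Let `d` be a metric (bounded by 1) on `X` with respect to which the
action `T` is 1-Lipschitz, and let `x ∈ X` be a transitive point. Then every
`d`-continuous map `S : X → X` commuting with every `T g` is a uniform limit of the maps
`T g`: for every `ε > 0` there exists `g ∈ G` with `⨆ y, d (T g y) (S y) < ε`. -/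
theorem commutant_in_closure_of_orbit_maps
    {G : Type*} [AddCommMonoid G] [Countable G]
    (hcancel : ∀ g h k : G, g + h = g + k → h = k)
    (hnoinv : ∀ g h : G, g + h = 0 → g = 0 ∧ h = 0)
    {X : Type*}
    (T : G → X → X)
    (hT0 : T 0 = id)
    (hTadd : ∀ g h : G, T (g + h) = T g ∘ T h)
    -- `d` is a metric on `X`, bounded by 1
    (d : X → X → ℝ)
    (hd_eq : ∀ x y : X, d x y = 0 ↔ x = y)
    (hd_symm : ∀ x y : X, d x y = d y x)
    (hd_tri : ∀ x y z : X, d x z ≤ d x y + d y z)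
    (hd_nonneg : ∀ x y : X, 0 ≤ d x y)
    (hd_bdd : ∀ x y : X, d x y ≤ 1)
    -- `T` is 1-Lipschitz with respect to `d`
    (hlip : ∀ (g : G) (x y : X), d (T g x) (T g y) ≤ d x y)
    -- `x` is a transitive point: the orbit of `x` is `d`-dense
    (x : X)
    (hx : ∀ (y : X) (ε : ℝ), 0 < ε → ∃ g : G, d (T g x) y < ε)
    -- `S` is `d`-continuous and commutes with the action
    (S : X → X)
    (hScont : ∀ (z : X) (ε : ℝ), 0 < ε → ∃ δ : ℝ, 0 < δ ∧
      ∀ w : X, d z w < δ → d (S z) (S w) < ε)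
    (hScomm : ∀ g : G, S ∘ T g = T g ∘ S) :
    ∀ ε : ℝ, 0 < ε → ∃ g : G, (⨆ y : X, d (T g y) (S y)) < ε := by
  intro ε hε
  obtain ⟨g, hg⟩ := hx (S x) (ε / 4) (by linarith)
  have : Nonempty X := ⟨x⟩
  refine ⟨g, lt_of_le_of_lt (ciSup_le fun y => ?_) (by linarith : 3 * (ε / 4) < ε)⟩
  obtain ⟨δ, hδ, hSy⟩ := hScont y (ε / 4) (by linarith)
  obtain ⟨h, hh⟩ := hx y (min δ (ε / 4)) (lt_min hδ (by linarith))
  have hy : d y (T h x) < min δ (ε / 4) := hd_symm y _ ▸ hh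
  have h_left : d (T g y) (T g (T h x)) < ε / 4 :=
    (hlip g _ _).trans_lt (hy.trans_le (min_le_right _ _))
  have h_right : d (S (T h x)) (S y) < ε / 4 :=
    hd_symm (S y) _ ▸ hSy _ (hy.trans_le (min_le_left _ _))
  have hT_comm : T g (T h x) = T h (T g x) := by
    have := congrFun ((hTadd g h).symm.trans (add_comm g h ▸ hTadd h g)) x
    simpa using this
  have hS_comm : S (T h x) = T h (S x) := congrFun (hScomm h) x
  have h_mid : d (T g (T h x)) (S (T h x)) < ε / 4 := by
    rw [hT_comm, hS_comm]
    exact (hlip h _ _).trans_lt hg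
  linarith [hd_tri (T g y) (T g (T h x)) (S y), hd_tri (T g (T h x)) (S (T h x)) (S y)]
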